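/- arXiv:2503.22258 — 2 statements merged into one kernel-verified Lean document; each statement's English description precedes it below -/
import Mathlib

section
/- Let G : ℝ^d → [0,∞) be locally bounded and weakly convex with modulus ρ_G > 0, fix t_max ∈ (0, 1/ρ_G), and set φ(s) = sup{‖p‖ : p ∈ ∂G(prox_{tG}(x)), ‖x‖ ≤ s, 0 < t ≤ t_max}. Then for every x ∈ ℝ^d the map t ↦ M_G^t(x) is Lipschitz continuous on [0, t_max) with the explicit bound |M_G^t(x) − M_G^s(x)| ≤ (|s−t|/2) φ(‖x‖)² for all s, t ∈ [0, t_max), where M_G^0 := G. -/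
noncomputable section

open scoped RealInnerProductSpace

variable {d : ℕ}

/-- Moreau envelope `M_G^t(x) = inf_y G(y) + ‖x-y‖²/(2t)` (with `M_G^0 := G`). -/
noncomputable def moreau (G : EuclideanSpace ℝ (Fin d) → ℝ) (t : ℝ)
    (x : EuclideanSpace ℝ (Fin d)) : ℝ :=
  if t = 0 then G x else ⨅ y : EuclideanSpace ℝ (Fin d), (G y + ‖x - y‖ ^ 2 / (2 * t))

/-- Proximal map `prox_{tG}(x)` as the set of minimizers of `y ↦ G(y) + ‖x-y‖²/(2t)`. -/
def proxSet (G : EuclideanSpace ℝ (Fin d) → ℝ) (t : ℝ)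
    (x : EuclideanSpace ℝ (Fin d)) : Set (EuclideanSpace ℝ (Fin d)) :=
  {p | ∀ y, G p + ‖x - p‖ ^ 2 / (2 * t) ≤ G y + ‖x - y‖ ^ 2 / (2 * t)}

/-- `G` is locally bounded: bounded above on a neighborhood of every point. -/
def LocBdd (G : EuclideanSpace ℝ (Fin d) → ℝ) : Prop :=
  ∀ x : EuclideanSpace ℝ (Fin d), ∃ U ∈ nhds x, BddAbove (G '' U)

/-- Regular (Fréchet) subdifferential: `v ∈ ∂G(x)` iff
`liminf_{y→x, y≠x} (G(y) − G(x) − ⟨v, y−x⟩)/‖y−x‖ ≥ 0`. -/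
def regSubdiff (G : EuclideanSpace ℝ (Fin d) → ℝ) (x : EuclideanSpace ℝ (Fin d)) :
    Set (EuclideanSpace ℝ (Fin d)) :=
  {v | ∀ ε > 0, ∀ᶠ y in nhdsWithin x {x}ᶜ,
    -(ε * ‖y - x‖) ≤ G y - G x - ⟪v, y - x⟫}

lemma geom_partition (m : ℝ → ℝ) (C s t : ℝ) (hs : 0 < s) (hst : s ≤ t)
    (h : ∀ a b, 0 < a → a ≤ b → b ≤ t → m a - m b ≤ C * (b - a) * (b / a)) :
    m s - m t ≤ C * (t - s) := by
  have ht : 0 < t := lt_of_lt_of_le hs hst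
  set L := Real.log (t / s) with hL
  have hL0 : 0 ≤ L := Real.log_nonneg (by rw [le_div_iff₀ hs]; linarith)
  have key : ∀ r : ℝ, 1 ≤ r → ∀ n : ℕ, s * r ^ n ≤ t →
      m s - m (s * r ^ n) ≤ C * (s * r ^ n - s) * r := by
    intro r hr n
    induction n with
    | zero => intro _; simp
    | succ k ih =>
      intro hk
      have hpos : 0 < s * r ^ k := by positivity
      have hle : s * r ^ k ≤ s * r ^ (k + 1) := by
        rw [pow_succ]; nlinarith
      have h1 := ih (hle.trans hk)
      have h2 := h _ _ hpos hle hk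
      have h3 : s * r ^ (k + 1) / (s * r ^ k) = r := by
        rw [pow_succ]; field_simp
      rw [h3] at h2
      linarith
  have key2 : ∀ n : ℕ, m s - m t ≤ C * (t - s) * Real.exp (L / ((n : ℝ) + 1)) := by
    intro n
    have hr : 1 ≤ Real.exp (L / ((n : ℝ) + 1)) := Real.one_le_exp (by positivity)
    have he : s * Real.exp (L / ((n : ℝ) + 1)) ^ (n + 1) = t := by
      rw [← Real.exp_nat_mul]
      have : ((n + 1 : ℕ) : ℝ) * (L / ((n : ℝ) + 1)) = L := by
        push_cast; field_simp
      rw [this, hL, Real.exp_log (by positivity)]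
      field_simp
    have := key _ hr (n + 1) he.le
    rwa [he] at this
  have hlim : Filter.Tendsto (fun n : ℕ => C * (t - s) * Real.exp (L / ((n : ℝ) + 1)))
      Filter.atTop (nhds (C * (t - s) * Real.exp 0)) := by
    refine Filter.Tendsto.const_mul _ ((Real.continuous_exp.tendsto 0).comp ?_)
    have := (tendsto_one_div_add_atTop_nhds_zero_nat (𝕜 := ℝ)).const_mul L
    simpa [div_eq_mul_inv] using this
  have := ge_of_tendsto' hlim key2
  simpa using this

lemma moreau_bdd (G : EuclideanSpace ℝ (Fin d) → ℝ) (hG0 : ∀ x, 0 ≤ G x) (t : ℝ) (ht : 0 < t)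
    (x : EuclideanSpace ℝ (Fin d)) :
    BddBelow (Set.range fun y : EuclideanSpace ℝ (Fin d) => (G y + ‖x - y‖ ^ 2 / (2 * t))) := by
  refine ⟨0, ?_⟩
  rintro _ ⟨y, rfl⟩
  have := hG0 y
  positivity

lemma moreau_le (G : EuclideanSpace ℝ (Fin d) → ℝ) (hG0 : ∀ x, 0 ≤ G x) (t : ℝ) (ht : 0 < t)
    (x y : EuclideanSpace ℝ (Fin d)) : moreau G t x ≤ G y + ‖x - y‖ ^ 2 / (2 * t) := by
  rw [moreau, if_neg ht.ne']
  exact ciInf_le (moreau_bdd G hG0 t ht x) y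

lemma moreau_eq (G : EuclideanSpace ℝ (Fin d) → ℝ) (hG0 : ∀ x, 0 ≤ G x) (t : ℝ) (ht : 0 < t)
    (x p : EuclideanSpace ℝ (Fin d)) (hp : p ∈ proxSet G t x) :
    moreau G t x = G p + ‖x - p‖ ^ 2 / (2 * t) := by
  apply le_antisymm (moreau_le G hG0 t ht x p)
  rw [moreau, if_neg ht.ne']
  exact le_ciInf hp

lemma prox_nonempty (G : EuclideanSpace ℝ (Fin d) → ℝ) (hG0 : ∀ x, 0 ≤ G x) (hc : Continuous G)
    (t : ℝ) (ht : 0 < t) (x : EuclideanSpace ℝ (Fin d)) : ∃ p, p ∈ proxSet G t x := by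
  have hcont : Continuous fun y : EuclideanSpace ℝ (Fin d) => G y + ‖x - y‖ ^ 2 / (2 * t) := by
    fun_prop
  refine hcont.exists_forall_le_of_isBounded x ?_
  refine (Metric.isBounded_closedBall (x := x) (r := Real.sqrt (2 * t * G x))).subset ?_
  intro y hy
  simp only [Set.mem_ofPred_eq, sub_self, norm_zero] at hy
  rw [Metric.mem_closedBall, dist_comm, dist_eq_norm]
  apply Real.le_sqrt_of_sq_le
  have h1 : ‖x - y‖ ^ 2 / (2 * t) ≤ G x := by
    have := hG0 y
    norm_num at hy
    linarith
  rw [div_le_iff₀ (by positivity)] at h1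
  linarith

lemma prox_subdiff (G : EuclideanSpace ℝ (Fin d) → ℝ)
    (t : ℝ) (ht : 0 < t) (x p : EuclideanSpace ℝ (Fin d)) (hp : p ∈ proxSet G t x) :
    t⁻¹ • (x - p) ∈ regSubdiff G p := by
  intro ε hε
  have hb : Metric.ball p (2 * t * ε) ∈ nhdsWithin p {p}ᶜ :=
    mem_nhdsWithin_of_mem_nhds (Metric.ball_mem_nhds _ (by positivity))
  filter_upwards [hb] with y hy
  rw [Metric.mem_ball, dist_eq_norm] at hy
  have h := hp y
  have e : ‖x - y‖ ^ 2 = ‖x - p‖ ^ 2 - 2 * ⟪x - p, y - p⟫ + ‖y - p‖ ^ 2 := by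
    rw [← norm_sub_sq_real]; congr 2; abel
  rw [e] at h
  rw [real_inner_smul_left]
  have h2 : (‖x - p‖ ^ 2 - 2 * ⟪x - p, y - p⟫ + ‖y - p‖ ^ 2) / (2 * t)
      = ‖x - p‖ ^ 2 / (2 * t) - t⁻¹ * ⟪x - p, y - p⟫ + ‖y - p‖ ^ 2 / (2 * t) := by
    field_simp
  rw [h2] at h
  have h3 : ‖y - p‖ ^ 2 / (2 * t) ≤ ε * ‖y - p‖ := by
    rw [div_le_iff₀ (by positivity)]
    nlinarith [norm_nonneg (y - p)]
  linarith

/-- with `φ(s) = sup{‖p‖ : p ∈ ∂G(prox_{tG}(x)), ‖x‖ ≤ s, 0 < t ≤ t_max}`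
(formalized through a function `φ` dominating all such subgradient norms), the map
`t ↦ M_G^t(x)` is Lipschitz on `[0, t_max)` with
`|M_G^t(x) − M_G^s(x)| ≤ (|s−t|/2) φ(‖x‖)²`. -/
theorem moreau_time_lipschitz
    (G : EuclideanSpace ℝ (Fin d) → ℝ) (hG0 : ∀ x, 0 ≤ G x) (hloc : LocBdd G)
    (ρG : ℝ) (hρ : 0 < ρG)
    (hwc : ConvexOn ℝ Set.univ (fun y => G y + ρG / 2 * ‖y‖ ^ 2))
    (tmax : ℝ) (htmax : tmax ∈ Set.Ioo (0 : ℝ) (1 / ρG))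
    (φ : ℝ → ℝ)
    (hφ : ∀ (x p v : EuclideanSpace ℝ (Fin d)) (t : ℝ), 0 < t → t ≤ tmax →
      p ∈ proxSet G t x → v ∈ regSubdiff G p → ‖v‖ ≤ φ ‖x‖) :
    ∀ x : EuclideanSpace ℝ (Fin d), ∀ s ∈ Set.Ico (0 : ℝ) tmax, ∀ t ∈ Set.Ico (0 : ℝ) tmax,
      |moreau G t x - moreau G s x| ≤ |s - t| / 2 * (φ ‖x‖) ^ 2 := by
  intro x
  have htm := htmax.1
  have hc : Continuous G := by
    have h1 := hwc.locallyLipschitz.continuous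
    have h2 : Continuous fun y : EuclideanSpace ℝ (Fin d) => ρG / 2 * ‖y‖ ^ 2 := by fun_prop
    have h3 := h1.sub h2
    refine h3.congr fun y => ?_
    simp
  have hbound : ∀ t p, 0 < t → t ≤ tmax → p ∈ proxSet G t x → ‖x - p‖ ≤ t * φ ‖x‖ := by
    intro t p ht htt hp
    have h := hφ x p _ t ht htt hp (prox_subdiff G t ht x p hp)
    rw [norm_smul, norm_inv, Real.norm_of_nonneg ht.le, inv_mul_le_iff₀ ht] at h
    exact h
  set F := φ ‖x‖ with hF
  have hmono : ∀ a b, 0 < a → a ≤ b → moreau G b x ≤ moreau G a x := by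
    intro a b ha hab
    obtain ⟨p, hp⟩ := prox_nonempty G hG0 hc a ha x
    rw [moreau_eq G hG0 a ha x p hp]
    refine (moreau_le G hG0 b (ha.trans_le hab) x p).trans ?_
    gcongr
  have hleG : ∀ a, 0 < a → moreau G a x ≤ G x := by
    intro a ha
    simpa using moreau_le G hG0 a ha x x
  have hloc2 : ∀ a b, 0 < a → a ≤ b → b ≤ tmax →
      moreau G a x - moreau G b x ≤ F ^ 2 / 2 * (b - a) * (b / a) := by
    intro a b ha hab hb
    have hb0 := ha.trans_le hab
    obtain ⟨p, hp⟩ := prox_nonempty G hG0 hc b hb0 x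
    have h1 := moreau_le G hG0 a ha x p
    have h2 := moreau_eq G hG0 b hb0 x p hp
    have h3 := hbound b p hb0 hb hp
    have h4 : ‖x - p‖ ^ 2 ≤ (b * F) ^ 2 := by gcongr
    have h5 : ‖x - p‖ ^ 2 / (2 * a) - ‖x - p‖ ^ 2 / (2 * b)
        = ‖x - p‖ ^ 2 * ((b - a) / (2 * a * b)) := by
      field_simp
    have h6 : ‖x - p‖ ^ 2 * ((b - a) / (2 * a * b)) ≤ (b * F) ^ 2 * ((b - a) / (2 * a * b)) := by
      have : 0 ≤ b - a := by linarith
      gcongr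
    have h7 : (b * F) ^ 2 * ((b - a) / (2 * a * b)) = F ^ 2 / 2 * (b - a) * (b / a) := by
      field_simp
    linarith
  have hpos : ∀ a b, 0 < a → a ≤ b → b ≤ tmax →
      moreau G a x - moreau G b x ≤ F ^ 2 / 2 * (b - a) := by
    intro a b ha hab hb
    exact geom_partition (fun t => moreau G t x) _ a b ha hab
      fun a' b' h1 h2 h3 => hloc2 a' b' h1 h2 (h3.trans hb)
  have hzero : ∀ b, 0 < b → b ≤ tmax → G x - moreau G b x ≤ F ^ 2 / 2 * b := by
    intro b hb0 hb
    choose! P hP using fun a (ha : 0 < a) => prox_nonempty G hG0 hc a ha x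
    have hPlim : Filter.Tendsto P (nhdsWithin 0 (Set.Ioi 0)) (nhds x) := by
      rw [tendsto_iff_norm_sub_tendsto_zero]
      have hl : Filter.Tendsto (fun a : ℝ => a * F) (nhdsWithin 0 (Set.Ioi 0)) (nhds 0) := by
        have : Continuous fun a : ℝ => a * F := by fun_prop
        have h := (this.tendsto 0).mono_left (nhdsWithin_le_nhds (s := Set.Ioi 0))
        simpa using h
      refine squeeze_zero' (Filter.Eventually.of_forall fun _ => norm_nonneg _) ?_ hl
      filter_upwards [Ioc_mem_nhdsGT htm] with a ha
      rw [norm_sub_rev]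
      exact hbound a _ ha.1 ha.2 (hP a ha.1)
    have hGlim := (hc.tendsto x).comp hPlim
    have hfin := hGlim.sub_const (moreau G b x)
    refine le_of_tendsto hfin ?_
    filter_upwards [Ioc_mem_nhdsGT hb0] with a ha
    have h1 := hpos a b ha.1 ha.2 hb
    have h2 := moreau_eq G hG0 a ha.1 x _ (hP a ha.1)
    have h3 : 0 ≤ ‖x - P a‖ ^ 2 / (2 * a) := by have := ha.1; positivity
    have h4 : 0 ≤ F ^ 2 / 2 * a := by have := ha.1; positivity
    simp only [Function.comp]
    linarith
  have main : ∀ a b, 0 ≤ a → a ≤ b → b ≤ tmax →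
      |moreau G b x - moreau G a x| ≤ (b - a) / 2 * F ^ 2 := by
    intro a b ha hab hb
    rcases ha.eq_or_lt with rfl | ha
    · rcases hab.eq_or_lt with rfl | hab
      · simp
      · have h0 : moreau G 0 x = G x := by simp [moreau]
        rw [h0, abs_le]
        have h1 := hzero b hab hb
        have h2 := hleG b hab
        have h3 : 0 ≤ (b - 0) / 2 * F ^ 2 := by rw [sub_zero]; positivity
        constructor <;> linarith
    · have h1 := hpos a b ha hab hb
      have h2 := hmono a b ha hab
      have h3 : 0 ≤ (b - a) / 2 * F ^ 2 := by
        have : 0 ≤ b - a := by linarith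
        positivity
      rw [abs_le]
      constructor <;> linarith
  intro s hs t ht
  rcases le_total s t with h | h
  · have := main s t hs.1 h ht.2.le
    rwa [abs_sub_comm s t, abs_of_nonneg (sub_nonneg.2 h)]
  · have := main t s ht.1 h hs.2.le
    rwa [abs_sub_comm, abs_of_nonneg (sub_nonneg.2 h)]
end
end

section
/- Let F : ℝ^d → [0,∞) be differentiable with Lipschitz gradient, let G : ℝ^d → [0,∞) be locally bounded and weakly convex with modulus ρ_G > 0, and assume either G is Lipschitz continuous or ∫ exp(−G(x)) dx < ∞. Fix t_max ∈ (0, 1/ρ_G), set U^t = F + M_G^t (with U^0 = F + G), φ(s) = sup{‖p‖ : p ∈ ∂G(prox_{tG}(x)), ‖x‖ ≤ s, 0 < t ≤ t_max}, and assume K_max := ∫ φ(‖x‖)² exp(−U^{t_max}(x)) dx < ∞. Then the map t ↦ Z_t := ∫ exp(−U^t(x)) dx is Lipschitz continuous on [0, t_max) with Lipschitz constant K_max/2, i.e., |Z_s − Z_t| ≤ (K_max/2)|s−t| for all s, t ∈ [0, t_max). -/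
noncomputable section

open MeasureTheory
open scoped RealInnerProductSpace

variable {d : ℕ}

lemma aux_cont {G : EuclideanSpace ℝ (Fin d) → ℝ} {ρG : ℝ}
    (hwc : ConvexOn ℝ Set.univ (fun y => G y + ρG / 2 * ‖y‖ ^ 2)) : Continuous G := by
  have h : Continuous (fun y => G y + ρG / 2 * ‖y‖ ^ 2) := hwc.locallyLipschitz.continuous
  have h2 : Continuous (fun y : EuclideanSpace ℝ (Fin d) => ρG / 2 * ‖y‖ ^ 2) := by fun_prop
  have e : G = fun y => (G y + ρG / 2 * ‖y‖ ^ 2) - ρG / 2 * ‖y‖ ^ 2 := by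
    funext y; ring
  rw [e]
  exact h.sub h2

lemma aux_le {G : EuclideanSpace ℝ (Fin d) → ℝ} (hG0 : ∀ x, 0 ≤ G x) {t : ℝ} (ht : 0 < t)
    (x y : EuclideanSpace ℝ (Fin d)) : moreau G t x ≤ G y + ‖x - y‖ ^ 2 / (2 * t) := by
  unfold moreau
  rw [if_neg ht.ne']
  refine ciInf_le ⟨0, ?_⟩ y
  rintro _ ⟨z, rfl⟩
  have := hG0 z
  positivity

lemma aux_prox {G : EuclideanSpace ℝ (Fin d) → ℝ} (hG0 : ∀ x, 0 ≤ G x) (hc : Continuous G)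
    {t : ℝ} (ht : 0 < t) (x : EuclideanSpace ℝ (Fin d)) :
    ∃ p ∈ proxSet G t x, moreau G t x = G p + ‖x - p‖ ^ 2 / (2 * t) ∧
      t⁻¹ • (x - p) ∈ regSubdiff G p := by
  have hf : Continuous (fun y => G y + ‖x - y‖ ^ 2 / (2 * t)) := by fun_prop
  have hlim : Filter.Tendsto (fun y => G y + ‖x - y‖ ^ 2 / (2 * t))
      (Filter.cocompact _) Filter.atTop := by
    have h1 : Filter.Tendsto (fun y => ‖x - y‖) (Filter.cocompact _) Filter.atTop := by
      have h := tendsto_dist_left_cocompact_atTop x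
      have e : dist x = fun y => ‖x - y‖ := by
        funext y; exact dist_eq_norm x y
      rwa [e] at h
    have h2 : Filter.Tendsto (fun y => ‖x - y‖ ^ 2 / (2 * t)) (Filter.cocompact _) Filter.atTop :=
      ((Filter.tendsto_pow_atTop two_ne_zero).comp h1).atTop_div_const (by positivity)
    exact Filter.tendsto_atTop_mono (fun y => by have := hG0 y; linarith) h2
  obtain ⟨p, hp⟩ := hf.exists_forall_le hlim
  refine ⟨p, hp, le_antisymm (aux_le hG0 ht x p) ?_, ?_⟩
  · unfold moreau
    rw [if_neg ht.ne']
    exact le_ciInf hp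
  · intro ε hε
    have hev : ∀ᶠ y in nhds p, ‖y - p‖ < 2 * t * ε := by
      have := Metric.ball_mem_nhds p (show 0 < 2 * t * ε by positivity)
      filter_upwards [this] with y hy
      simpa [dist_eq_norm] using hy
    filter_upwards [nhdsWithin_le_nhds hev] with y hy
    have h := hp y
    have e : ‖x - y‖ ^ 2 = ‖x - p‖ ^ 2 - 2 * ⟪x - p, y - p⟫ + ‖y - p‖ ^ 2 := by
      rw [← norm_sub_sq_real]; congr 2; abel
    rw [e] at h
    rw [real_inner_smul_left]
    have h3 : (‖x - p‖ ^ 2 - 2 * ⟪x - p, y - p⟫ + ‖y - p‖ ^ 2) / (2 * t)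
       = ‖x - p‖ ^ 2 / (2 * t) - t⁻¹ * ⟪x - p, y - p⟫ + ‖y - p‖ ^ 2 / (2 * t) := by
      field_simp
    have h4 : ‖y - p‖ ^ 2 / (2 * t) ≤ ε * ‖y - p‖ := by
      rw [div_le_iff₀ (by positivity)]
      nlinarith [norm_nonneg (y - p)]
    linarith

/-- Weak one-step estimate. -/
lemma aux_step {G : EuclideanSpace ℝ (Fin d) → ℝ} (hG0 : ∀ x, 0 ≤ G x) (hc : Continuous G)
    {tmax c : ℝ} {x : EuclideanSpace ℝ (Fin d)}
    (hφ : ∀ (p v : EuclideanSpace ℝ (Fin d)) (t : ℝ), 0 < t → t ≤ tmax →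
      p ∈ proxSet G t x → v ∈ regSubdiff G p → ‖v‖ ≤ c)
    {s t : ℝ} (hs : 0 < s) (hst : s ≤ t) (ht : t ≤ tmax) :
    moreau G s x - moreau G t x ≤ c ^ 2 / 2 * (t - s) * (t / s) := by
  have ht0 : 0 < t := hs.trans_le hst
  obtain ⟨p, hp, hm, hv⟩ := aux_prox hG0 hc ht0 x
  have h1 := hφ p _ t ht0 ht hp hv
  have h2 := aux_le hG0 hs x p
  rw [norm_smul, Real.norm_of_nonneg (by positivity)] at h1
  have h3 : ‖x - p‖ ≤ t * c := by
    rwa [inv_mul_le_iff₀ ht0] at h1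
  have h4 : ‖x - p‖ ^ 2 ≤ (t * c) ^ 2 := pow_le_pow_left₀ (norm_nonneg _) h3 2
  have h5 : ‖x - p‖ ^ 2 / (2 * s) - ‖x - p‖ ^ 2 / (2 * t)
      = ‖x - p‖ ^ 2 * ((t - s) / (2 * s * t)) := by
    field_simp
  have h6 : c ^ 2 / 2 * (t - s) * (t / s) = (t * c) ^ 2 * ((t - s) / (2 * s * t)) := by
    field_simp
  have h7 : 0 ≤ (t - s) / (2 * s * t) := div_nonneg (by linarith) (by positivity)
  rw [h6]
  have := mul_le_mul_of_nonneg_right h4 h7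
  linarith

lemma aux_pos {G : EuclideanSpace ℝ (Fin d) → ℝ} (hG0 : ∀ x, 0 ≤ G x) (hc : Continuous G)
    {tmax c : ℝ} {x : EuclideanSpace ℝ (Fin d)}
    (hφ : ∀ (p v : EuclideanSpace ℝ (Fin d)) (t : ℝ), 0 < t → t ≤ tmax →
      p ∈ proxSet G t x → v ∈ regSubdiff G p → ‖v‖ ≤ c)
    {s t : ℝ} (hs : 0 < s) (hst : s ≤ t) (ht : t ≤ tmax) :
    moreau G s x - moreau G t x ≤ c ^ 2 / 2 * (t - s) := by
  have key : ∀ δ : ℝ, 0 ≤ δ → ∀ i : ℕ, s + i * δ ≤ tmax →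
      moreau G s x - moreau G (s + i * δ) x ≤ c ^ 2 / 2 * (i * δ) * (1 + δ / s) := by
    intro δ hδ i
    induction i with
    | zero => simp
    | succ i ih =>
      intro h
      push_cast at h ⊢
      have hi : 0 ≤ (i : ℝ) * δ := by positivity
      have h1 := ih (by linarith)
      have h2 := aux_step hG0 hc hφ (s := s + i * δ) (t := s + (i + 1) * δ) (by linarith)
        (by linarith) h
      have h3 : (s + (i + 1) * δ) / (s + i * δ) ≤ 1 + δ / s := by
        have : (s + (i + 1) * δ) / (s + i * δ) = 1 + δ / (s + i * δ) := by
          have : s + i * δ ≠ 0 := by positivity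
          field_simp
          ring
        rw [this]
        gcongr
        linarith
      have h4 : c ^ 2 / 2 * (s + (i + 1) * δ - (s + i * δ)) *
          ((s + (i + 1) * δ) / (s + i * δ)) ≤ c ^ 2 / 2 * δ * (1 + δ / s) := by
        have : s + (i + 1) * δ - (s + i * δ) = δ := by ring
        rw [this]
        gcongr
      linarith
  have hn : ∀ n : ℕ, moreau G s x - moreau G t x ≤
      c ^ 2 / 2 * (t - s) * (1 + ((t - s) / s) * (1 / ((n : ℝ) + 1))) := by
    intro n
    have hn0 : (n : ℝ) + 1 ≠ 0 := by positivity
    have e : ((n + 1 : ℕ) : ℝ) * ((t - s) / (n + 1)) = t - s := by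
      push_cast; field_simp
    have h := key ((t - s) / (n + 1)) (div_nonneg (by linarith) (by positivity)) (n + 1)
      (by rw [e]; linarith)
    rw [e] at h
    rw [show s + (t - s) = t by ring] at h
    refine h.trans (le_of_eq ?_)
    congr 2
    field_simp
  have hlim : Filter.Tendsto (fun n : ℕ => c ^ 2 / 2 * (t - s) *
      (1 + ((t - s) / s) * (1 / ((n : ℝ) + 1)))) Filter.atTop
      (nhds (c ^ 2 / 2 * (t - s) * (1 + ((t - s) / s) * 0))) :=
    ((tendsto_one_div_add_atTop_nhds_zero_nat.const_mul _).const_add _).const_mul _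
  have := ge_of_tendsto' hlim hn
  simpa using this

lemma aux_nonneg {G : EuclideanSpace ℝ (Fin d) → ℝ} (hG0 : ∀ x, 0 ≤ G x) (hc : Continuous G)
    {tmax c : ℝ} {x : EuclideanSpace ℝ (Fin d)}
    (hφ : ∀ (p v : EuclideanSpace ℝ (Fin d)) (t : ℝ), 0 < t → t ≤ tmax →
      p ∈ proxSet G t x → v ∈ regSubdiff G p → ‖v‖ ≤ c)
    {s t : ℝ} (hs : 0 ≤ s) (hst : s ≤ t) (ht : t ≤ tmax) :
    moreau G s x - moreau G t x ≤ c ^ 2 / 2 * (t - s) := by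
  rcases hs.eq_or_lt with rfl | hs
  swap
  · exact aux_pos hG0 hc hφ hs hst ht
  rcases hst.eq_or_lt with rfl | ht0
  · simp
  have h0 : moreau G 0 x = G x := by simp [moreau]
  rw [h0]
  set u : ℕ → ℝ := fun n => t * (1 / ((n : ℝ) + 1)) with hu
  have hupos : ∀ n, 0 < u n := fun n => by simp only [hu]; positivity
  have hule : ∀ n, u n ≤ t := fun n => by
    have : 1 / ((n : ℝ) + 1) ≤ 1 := by
      rw [div_le_one (by positivity)]
      have : (0 : ℝ) ≤ n := by positivity
      linarith
    simp only [hu]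
    nlinarith
  have hulim : Filter.Tendsto u Filter.atTop (nhds 0) := by
    have h := (tendsto_one_div_add_atTop_nhds_zero_nat (𝕜 := ℝ)).const_mul t
    rwa [mul_zero] at h
  choose p hp hm hv using fun n => aux_prox hG0 hc (hupos n) x
  have hnorm : ∀ n, ‖x - p n‖ ≤ u n * c := fun n => by
    have h1 := hφ (p n) _ (u n) (hupos n) ((hule n).trans ht) (hp n) (hv n)
    rw [norm_smul, Real.norm_of_nonneg (inv_nonneg.2 (hupos n).le)] at h1
    rwa [inv_mul_le_iff₀ (hupos n)] at h1
  have hplim : Filter.Tendsto p Filter.atTop (nhds x) := by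
    rw [tendsto_iff_norm_sub_tendsto_zero]
    refine squeeze_zero (g := fun n => u n * c) (fun _ => norm_nonneg _)
      (fun n => by rw [norm_sub_rev]; exact hnorm n) ?_
    simpa using hulim.mul_const c
  have hb : ∀ n, G (p n) ≤ moreau G t x + c ^ 2 / 2 * t := fun n => by
    have h1 := aux_pos hG0 hc hφ (hupos n) (hule n) ht
    have h2 : 0 ≤ ‖x - p n‖ ^ 2 / (2 * u n) := by have := hupos n; positivity
    have h3 : c ^ 2 / 2 * (t - u n) ≤ c ^ 2 / 2 * t := by
      have := hupos n
      gcongr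
      linarith
    have := hm n
    linarith
  have := le_of_tendsto' ((hc.tendsto x).comp hplim) hb
  linarith

lemma aux_anti {G : EuclideanSpace ℝ (Fin d) → ℝ} (hG0 : ∀ x, 0 ≤ G x) (hc : Continuous G)
    {s t : ℝ} (hs : 0 ≤ s) (hst : s ≤ t) (x : EuclideanSpace ℝ (Fin d)) :
    moreau G t x ≤ moreau G s x := by
  rcases hs.eq_or_lt with rfl | hs
  · rcases hst.eq_or_lt with rfl | ht0
    · exact le_rfl
    · have := aux_le hG0 ht0 x x
      simpa [moreau] using this
  · obtain ⟨p, -, hm, -⟩ := aux_prox hG0 hc hs x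
    rw [hm]
    refine (aux_le hG0 (hs.trans_le hst) x p).trans ?_
    gcongr

/-- the normalization constant `Z_t = ∫ exp(−F(x) − M_G^t(x)) dx` is
Lipschitz continuous on `[0, t_max)` with Lipschitz constant `K_max/2`. -/
theorem partition_function_lipschitz
    (F G : EuclideanSpace ℝ (Fin d) → ℝ)
    (hF0 : ∀ x, 0 ≤ F x) (hG0 : ∀ x, 0 ≤ G x)
    (hFdiff : Differentiable ℝ F)
    (hFlip : ∃ L : NNReal, LipschitzWith L (fun x => gradient F x))
    (hloc : LocBdd G) (ρG : ℝ) (hρ : 0 < ρG)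
    (hwc : ConvexOn ℝ Set.univ (fun y => G y + ρG / 2 * ‖y‖ ^ 2))
    (hGint : (∃ L : NNReal, LipschitzWith L G) ∨
      Integrable (fun x : EuclideanSpace ℝ (Fin d) => Real.exp (-G x)))
    (tmax : ℝ) (htmax : tmax ∈ Set.Ioo (0 : ℝ) (1 / ρG))
    (φ : ℝ → ℝ)
    (hφ : ∀ (x p v : EuclideanSpace ℝ (Fin d)) (t : ℝ), 0 < t → t ≤ tmax →
      p ∈ proxSet G t x → v ∈ regSubdiff G p → ‖v‖ ≤ φ ‖x‖)
    (hKint : Integrable (fun x : EuclideanSpace ℝ (Fin d) =>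
      (φ ‖x‖) ^ 2 * Real.exp (-(F x + moreau G tmax x))))
    (hZint : ∀ u ∈ Set.Icc (0 : ℝ) tmax,
      Integrable (fun x : EuclideanSpace ℝ (Fin d) => Real.exp (-(F x + moreau G u x)))) :
    ∀ s ∈ Set.Ico (0 : ℝ) tmax, ∀ t ∈ Set.Ico (0 : ℝ) tmax,
      |(∫ x : EuclideanSpace ℝ (Fin d), Real.exp (-(F x + moreau G s x))) -
        (∫ x : EuclideanSpace ℝ (Fin d), Real.exp (-(F x + moreau G t x)))| ≤
      (∫ x : EuclideanSpace ℝ (Fin d),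
        (φ ‖x‖) ^ 2 * Real.exp (-(F x + moreau G tmax x))) / 2 * |s - t| := by
  have hc : Continuous G := aux_cont hwc
  have main : ∀ s t : ℝ, 0 ≤ s → s ≤ t → t < tmax →
      |(∫ x : EuclideanSpace ℝ (Fin d), Real.exp (-(F x + moreau G s x))) -
        (∫ x : EuclideanSpace ℝ (Fin d), Real.exp (-(F x + moreau G t x)))| ≤
      (∫ x : EuclideanSpace ℝ (Fin d),
        (φ ‖x‖) ^ 2 * Real.exp (-(F x + moreau G tmax x))) / 2 * |s - t| := by
    intro s t hs hst ht
    have is := hZint s ⟨hs, by linarith⟩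
    have it := hZint t ⟨by linarith, by linarith⟩
    have hmono : (∫ x : EuclideanSpace ℝ (Fin d), Real.exp (-(F x + moreau G s x))) ≤
        ∫ x : EuclideanSpace ℝ (Fin d), Real.exp (-(F x + moreau G t x)) := by
      refine integral_mono is it fun x => ?_
      have := aux_anti hG0 hc hs hst x
      exact Real.exp_le_exp.2 (by linarith)
    rw [abs_sub_comm, abs_of_nonneg (by linarith), abs_sub_comm, abs_of_nonneg (by linarith),
      ← integral_sub it is]
    have e : (∫ x : EuclideanSpace ℝ (Fin d),
        (φ ‖x‖) ^ 2 * Real.exp (-(F x + moreau G tmax x))) / 2 * (t - s) =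
        ∫ x : EuclideanSpace ℝ (Fin d),
        (φ ‖x‖) ^ 2 * Real.exp (-(F x + moreau G tmax x)) * ((t - s) / 2) := by
      rw [integral_mul_const]; ring
    rw [e]
    refine integral_mono (it.sub is) (hKint.mul_const _) fun x => ?_
    have h1 := aux_nonneg hG0 hc (x := x) (c := φ ‖x‖) (fun p v t => hφ x p v t) hs hst ht.le
    have h2 := aux_anti hG0 hc (hs.trans hst) ht.le x
    have h3 := aux_anti hG0 hc hs hst x
    have h4 : Real.exp (-(F x + moreau G t x)) ≤ Real.exp (-(F x + moreau G tmax x)) :=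
      Real.exp_le_exp.2 (by linarith)
    have h5 : Real.exp (-(F x + moreau G s x)) = Real.exp (-(F x + moreau G t x)) *
        Real.exp (-(moreau G s x - moreau G t x)) := by
      rw [← Real.exp_add]; congr 1; ring
    have h6 := Real.add_one_le_exp (-(moreau G s x - moreau G t x))
    have h7 := Real.exp_pos (-(F x + moreau G t x))
    show Real.exp (-(F x + moreau G t x)) - Real.exp (-(F x + moreau G s x)) ≤ _
    calc Real.exp (-(F x + moreau G t x)) - Real.exp (-(F x + moreau G s x))
        ≤ Real.exp (-(F x + moreau G t x)) * (moreau G s x - moreau G t x) := by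
          rw [h5]; nlinarith
      _ ≤ Real.exp (-(F x + moreau G tmax x)) * (φ ‖x‖ ^ 2 / 2 * (t - s)) :=
          mul_le_mul h4 h1 (by linarith) (Real.exp_pos _).le
      _ = _ := by ring
  intro s hs t ht
  rcases le_total s t with h | h
  · exact main s t hs.1 h ht.2
  · have := main t s ht.1 h hs.2
    rwa [abs_sub_comm, abs_sub_comm t s] at this
end
end
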